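/- Let X be a set, let ⋆ and □ be sup-compatible relations on the filters on X, and let J be a steady class of filters on X (F ∨ G ∈ J whenever F, G ∈ J and F # G). Then J^⋆ is ((J^⋆)^□, J^□)-steady: whenever F ∈ J^⋆, H ∈ (J^⋆)^□ and F # H, one has F ∨ H ∈ J^□. In particular, taking □ = ⋆, J^⋆ is (J^⋆)^⋆-steady. -/

import Mathlib

open Filter Set

variable {X : Type*}

/-- Two filters mesh if all their members intersect, i.e. the filter generated by
pairwise intersections (which is `F ⊓ G` in Mathlib's order) is proper. -/
def Mesh (F G : Filter X) : Prop := Filter.NeBot (F ⊓ G)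

/-- A relation on the filters on `X` is sup-compatible if it is symmetric, holds for
non-meshing pairs, and satisfies `F ⋆ (G ∨ H) → (F ∨ H) ⋆ G` when `G # F` and `F # H`
(the paper's `∨` of filters is Mathlib's `⊓`). -/
def SupCompatible (r : Filter X → Filter X → Prop) : Prop :=
  (∀ F G, r F G → r G F) ∧
  (∀ F G, ¬ Mesh F G → r F G) ∧
  (∀ F G H, Mesh G F → Mesh F H → r F (G ⊓ H) → r (F ⊓ H) G)

/-- The polar `J^⋆` of a class of filters. -/
def polar (r : Filter X → Filter X → Prop) (J : Set (Filter X)) : Set (Filter X) :=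
  {F | ∀ G ∈ J, r F G}

/-- `J` is `(D, M)`-steady. -/
def Steady (J D M : Set (Filter X)) : Prop :=
  ∀ F ∈ J, ∀ H ∈ D, Mesh F H → F ⊓ H ∈ M

theorem Mesh.mono {F G F' G' : Filter X} (h : Mesh F G) (hle : F ⊓ G ≤ F' ⊓ G') :
    Mesh F' G' :=
  Filter.NeBot.mono h hle

/-- If `J` is steady, then `J^⋆` is `(J, J^⋆)`-steady. -/
theorem SupCompatible.steady_polar {r : Filter X → Filter X → Prop} (hr : SupCompatible r)
    {J : Set (Filter X)} (hJ : Steady J J J) : Steady (polar r J) J (polar r J) := by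
  intro F hF G hG hFG K hK
  by_cases h : Mesh (F ⊓ G) K
  · have hKG : Mesh K G :=
      h.mono (le_inf inf_le_right (inf_le_left.trans inf_le_right))
    have hKF : Mesh K F :=
      h.mono (le_inf inf_le_right (inf_le_left.trans inf_le_left))
    exact hr.2.2 F K G hKF hFG (hF _ (hJ K hK G hG hKG))
  · exact hr.2.1 _ _ h

/-- If `J` is steady, then `J^⋆` is `((J^⋆)^□, J^□)`-steady. -/
theorem SupCompatible.steady_polar_polar {r s : Filter X → Filter X → Prop}
    (hr : SupCompatible r) (hs : SupCompatible s) {J : Set (Filter X)} (hJ : Steady J J J) :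
    Steady (polar r J) (polar s (polar r J)) (polar s J) := by
  intro F hF H hH hFH G hG
  by_cases h : Mesh (F ⊓ H) G
  · have hFG : Mesh F G :=
      h.mono (le_inf (inf_le_left.trans inf_le_left) inf_le_right)
    have hGH : Mesh G H :=
      h.mono (le_inf inf_le_right (inf_le_left.trans inf_le_right))
    have hH' : s H (G ⊓ F) := by
      rw [inf_comm G F]
      exact hH _ (hr.steady_polar hJ F hF G hG hFG)
    rw [inf_comm F H]
    exact hs.2.2 H G F hGH (hFH.mono (inf_comm F H).le) hH'
  · exact hs.2.1 _ _ h

theorem stmt2 (star square : Filter X → Filter X → Prop)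
    (hstar : SupCompatible star) (hsquare : SupCompatible square)
    (J : Set (Filter X)) (hJ : Steady J J J) :
    -- `J^⋆` is `((J^⋆)^□, J^□)`-steady ...
    Steady (polar star J) (polar square (polar star J)) (polar square J) ∧
    -- ... and in particular (taking `□ = ⋆`) `J^⋆` is `(J^⋆)^⋆`-steady.
    Steady (polar star J) (polar star (polar star J)) (polar star J) := by
  exact ⟨hstar.steady_polar_polar hsquare hJ, hstar.steady_polar_polar hstar hJ⟩
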